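/- arXiv:2410.22019 — 3 statements merged into one kernel-verified Lean document; each statement's English description precedes it below -/
import Mathlib

section
/- Let a_1 < a_2 < a_3 < a_4 be nonnegative integers. If δ_1 > δ_2, then δ_1 ≠ δ_3. -/
/-- For distinct nonnegative integers `a` and `b`, `bdelta a b` is the largest index `i`
such that the `i`-th binary digits of `a` and `b` differ. -/
noncomputable def bdelta (a b : ℕ) : ℕ := sSup {i | a.testBit i ≠ b.testBit i}

theorem bddAbove_testBit_ne (a b : ℕ) : BddAbove {i | a.testBit i ≠ b.testBit i} := by
  refine ⟨a + b, fun i hi => ?_⟩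
  by_contra! hlt
  have hpow : i < 2 ^ i := Nat.lt_two_pow_self
  exact hi (by rw [Nat.testBit_lt_two_pow (by omega), Nat.testBit_lt_two_pow (by omega)])

theorem testBit_eq_of_bdelta_lt {a b i : ℕ} (h : bdelta a b < i) :
    a.testBit i = b.testBit i := by
  by_contra hne
  exact absurd (le_csSup (bddAbove_testBit_ne a b) hne) (not_le.mpr h)

theorem testBit_bdelta_ne {a b : ℕ} (h : a ≠ b) :
    a.testBit (bdelta a b) ≠ b.testBit (bdelta a b) :=
  Nat.sSup_mem (Nat.exists_testBit_ne_of_ne h) (bddAbove_testBit_ne a b)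

theorem testBit_bdelta_of_lt {a b : ℕ} (h : a < b) :
    a.testBit (bdelta a b) = false ∧ b.testBit (bdelta a b) = true := by
  have hne := testBit_bdelta_ne h.ne
  cases ha : a.testBit (bdelta a b) <;> cases hb : b.testBit (bdelta a b)
  · simp [ha, hb] at hne
  · simp
  · exact absurd h (Nat.lt_of_testBit _ hb ha
      fun j hj => (testBit_eq_of_bdelta_lt hj).symm).not_gt
  · simp [ha, hb] at hne

/-- Let `a₁ < a₂ < a₃ < a₄` be nonnegative integers. If `δ₁ > δ₂`, then `δ₁ ≠ δ₃`,
where `δᵢ = δ(aᵢ, aᵢ₊₁)`. -/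
theorem stmt7 (a1 a2 a3 a4 : ℕ) (h12 : a1 < a2) (h23 : a2 < a3) (h34 : a3 < a4)
    (h : bdelta a2 a3 < bdelta a1 a2) : bdelta a1 a2 ≠ bdelta a3 a4 := by
  intro heq
  have h2 := (testBit_bdelta_of_lt h12).2
  have h3 := (testBit_bdelta_of_lt h34).1
  rw [testBit_eq_of_bdelta_lt h, heq, h3] at h2
  exact Bool.false_ne_true h2
end

section
/- Let n ≥ 1 and let a_1 < a_2 < ... < a_m be nonnegative integers with m = 2^{2n}. Then there exist indices i_1 < i_2 < ... < i_{n+1} such that the sequence δ(a_{i_1}, a_{i_2}), δ(a_{i_2}, a_{i_3}), ..., δ(a_{i_n}, a_{i_{n+1}}) is strictly monotone (strictly increasing or strictly decreasing). -/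
theorem testBit_eq_of_div_two_pow_eq {x y k i : ℕ} (h : x / 2 ^ k = y / 2 ^ k) (hi : k ≤ i) :
    x.testBit i = y.testBit i := by
  obtain ⟨j, rfl⟩ := Nat.exists_eq_add_of_le' hi
  rw [← Nat.testBit_div_two_pow, ← Nat.testBit_div_two_pow, h]

theorem bdelta_lt {x y k : ℕ} (h : x / 2 ^ k = y / 2 ^ k) (hne : x ≠ y) : bdelta x y < k := by
  have hlt : ∀ i ∈ {i | x.testBit i ≠ y.testBit i}, i < k := fun i hi => by
    by_contra! hk
    exact hi (testBit_eq_of_div_two_pow_eq h hk)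
  exact hlt _ (Nat.sSup_mem (Nat.exists_testBit_ne_of_ne hne) ⟨k, fun i hi => (hlt i hi).le⟩)

theorem bdelta_eq {x y k c : ℕ} (hx : x / 2 ^ k = 2 * c) (hy : y / 2 ^ k = 2 * c + 1) :
    bdelta x y = k := by
  refine IsGreatest.csSup_eq ⟨?_, fun i hi => ?_⟩
  · simp [Nat.testBit_eq_decide_div_mod_eq, hx, hy]
  · by_contra! hk
    refine hi (testBit_eq_of_div_two_pow_eq (k := k + 1) ?_ hk)
    rw [pow_succ, ← Nat.div_div_eq_div_mul, ← Nat.div_div_eq_div_mul, hx, hy]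
    omega

/-- An increasing sequence `a 0 < ⋯ < a p` in `S` whose consecutive values of `bdelta` are
strictly ordered by `r`. -/
def IsDeltaChain (r : ℕ → ℕ → Prop) (S : Finset ℕ) (p : ℕ) (a : ℕ → ℕ) : Prop :=
  (∀ j ≤ p, a j ∈ S) ∧ (∀ j < p, a j < a (j + 1)) ∧
    ∀ j, j + 1 < p → r (bdelta (a j) (a (j + 1))) (bdelta (a (j + 1)) (a (j + 2)))

theorem IsDeltaChain.mono {r : ℕ → ℕ → Prop} {S T : Finset ℕ} {p : ℕ} {a : ℕ → ℕ}
    (h : IsDeltaChain r S p a) (hST : S ⊆ T) : IsDeltaChain r T p a :=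
  ⟨fun j hj => hST (h.1 j hj), h.2⟩

theorem isDeltaChain_zero (r : ℕ → ℕ → Prop) {S : Finset ℕ} {x : ℕ} (hx : x ∈ S) :
    IsDeltaChain r S 0 fun _ => x :=
  ⟨fun _ _ => hx, by simp, by simp⟩

theorem IsDeltaChain.append {S T : Finset ℕ} {p y : ℕ} {a : ℕ → ℕ}
    (h : IsDeltaChain (· < ·) S p a) (hST : S ⊆ T) (hy : y ∈ T) (hlt : ∀ x ∈ S, x < y)
    (hd : ∀ x ∈ S, ∀ x' ∈ S, ∀ z ∈ S, x < x' → bdelta x x' < bdelta z y) :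
    IsDeltaChain (· < ·) T (p + 1) fun j => if j ≤ p then a j else y := by
  obtain ⟨hS, hm, hr⟩ := h
  refine ⟨fun j _ => ?_, fun j hj => ?_, fun j hj => ?_⟩
  · dsimp only
    split_ifs with hjp
    exacts [hST (hS j hjp), hy]
  · have hjp : j ≤ p := by omega
    simp only [hjp, if_true]
    split_ifs with hjp'
    exacts [hm j hjp', hlt _ (hS j hjp)]
  · have hjp : j ≤ p := by omega
    have hjp' : j + 1 ≤ p := by omega
    simp only [hjp, hjp', if_true]
    split_ifs with hj2
    exacts [hr j hj2, hd _ (hS j hjp) _ (hS _ hjp') _ (hS _ hjp') (hm j hjp')]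

theorem IsDeltaChain.prepend {S T : Finset ℕ} {p y : ℕ} {a : ℕ → ℕ}
    (h : IsDeltaChain (· > ·) S p a) (hST : S ⊆ T) (hy : y ∈ T) (hlt : ∀ x ∈ S, y < x)
    (hd : ∀ x ∈ S, ∀ x' ∈ S, ∀ z ∈ S, x < x' → bdelta x x' < bdelta y z) :
    IsDeltaChain (· > ·) T (p + 1) fun j => Nat.casesOn j y a := by
  obtain ⟨hS, hm, hr⟩ := h
  refine ⟨fun j hj => ?_, fun j hj => ?_, fun j hj => ?_⟩
  · cases j with
    | zero => exact hy
    | succ j => exact hST (hS j (by omega))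
  · cases j with
    | zero => exact hlt _ (hS 0 (by omega))
    | succ j => exact hm j (by omega)
  · cases j with
    | zero => exact hd _ (hS 0 (by omega)) _ (hS 1 (by omega)) _ (hS 0 (by omega)) (hm 0 (by omega))
    | succ j => exact hr j (by omega)

theorem exists_isDeltaChain (k : ℕ) : ∀ (c p q : ℕ) (S : Finset ℕ), (∀ x ∈ S, x / 2 ^ k = c) →
    2 ^ (p + q) ≤ S.card →
    (∃ a, IsDeltaChain (· < ·) S p a) ∨ ∃ a, IsDeltaChain (· > ·) S q a := by
  induction k with
  | zero =>
    intro c p q S hc hS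
    obtain ⟨x, hx⟩ := Finset.card_pos.1 (lt_of_lt_of_le (by positivity) hS)
    have hcard : S.card ≤ 1 := Finset.card_le_one.2 fun x hx y hy => by
      have := hc x hx
      have := hc y hy
      simp_all
    have hpq : p + q = 0 := by
      by_contra h
      have := Nat.one_lt_two_pow h
      omega
    obtain rfl : p = 0 := by omega
    exact .inl ⟨_, isDeltaChain_zero _ hx⟩
  | succ k ih =>
    intro c p q S hc hS
    obtain ⟨x, hx⟩ := Finset.card_pos.1 (lt_of_lt_of_le (by positivity) hS)
    rcases p with _ | p
    · exact .inl ⟨_, isDeltaChain_zero _ hx⟩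
    rcases q with _ | q
    · exact .inr ⟨_, isDeltaChain_zero _ hx⟩
    set A := S.filter fun x => x / 2 ^ k = 2 * c
    set B := S.filter fun x => ¬ x / 2 ^ k = 2 * c
    have hAS : A ⊆ S := Finset.filter_subset _ _
    have hBS : B ⊆ S := Finset.filter_subset _ _
    have hA' : ∀ x ∈ A, x / 2 ^ k = 2 * c := fun x hx => (Finset.mem_filter.1 hx).2
    have hB' : ∀ x ∈ B, x / 2 ^ k = 2 * c + 1 := fun x hx => by
      obtain ⟨hxS, hne⟩ := Finset.mem_filter.1 hx
      have := hc x hxS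
      rw [pow_succ, ← Nat.div_div_eq_div_mul] at this
      omega
    have hAB : A.card + B.card = S.card := Finset.card_filter_add_card_filter_not _
    have hlt : ∀ x ∈ A, ∀ y ∈ B, x < y := fun x hx y hy => by
      refine Nat.lt_of_div_lt_div (c := 2 ^ k) ?_
      rw [hA' x hx, hB' y hy]
      omega
    rcases A.eq_empty_or_nonempty with hA0 | ⟨y, hy⟩
    · have : B.card = S.card := by simpa [hA0] using hAB
      exact (ih _ (p + 1) (q + 1) B hB' (this ▸ hS)).imp
        (fun ⟨a, h⟩ => ⟨a, h.mono hBS⟩) fun ⟨a, h⟩ => ⟨a, h.mono hBS⟩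
    rcases B.eq_empty_or_nonempty with hB0 | ⟨z, hz⟩
    · have : A.card = S.card := by simpa [hB0] using hAB
      exact (ih _ (p + 1) (q + 1) A hA' (this ▸ hS)).imp
        (fun ⟨a, h⟩ => ⟨a, h.mono hAS⟩) fun ⟨a, h⟩ => ⟨a, h.mono hAS⟩
    have hpow : 2 ^ (p + 1 + (q + 1)) = 2 * 2 ^ (p + q + 1) := by ring
    rcases le_total (2 ^ (p + q + 1)) A.card with h | h
    · refine (ih _ p (q + 1) A hA' h).imp (fun ⟨a, h⟩ => ⟨_, h.append hAS (hBS hz)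
        (fun x hx => hlt x hx z hz) fun x hx x' hx' w hw hxx' => ?_⟩) fun ⟨a, h⟩ => ⟨a, h.mono hAS⟩
      rw [bdelta_eq (hA' w hw) (hB' z hz)]
      exact bdelta_lt ((hA' x hx).trans (hA' x' hx').symm) hxx'.ne
    · have hB2 : 2 ^ (p + 1 + q) ≤ B.card := by
        rw [add_right_comm]
        omega
      refine (ih _ (p + 1) q B hB' hB2).imp (fun ⟨a, h⟩ => ⟨a, h.mono hBS⟩) fun ⟨a, h⟩ =>
        ⟨_, h.prepend hBS (hAS hy) (fun x hx => hlt y hy x hx) fun x hx x' hx' w hw hxx' => ?_⟩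
      rw [bdelta_eq (hA' y hy) (hB' w hw)]
      exact bdelta_lt ((hB' x hx).trans (hB' x' hx').symm) hxx'.ne

/-- A chain in the range of a strictly monotone `b`, written in terms of indices. -/
theorem IsDeltaChain.exists_index {r : ℕ → ℕ → Prop} {N n : ℕ} {b : Fin N → ℕ} (hb : StrictMono b)
    {a : ℕ → ℕ} (h : IsDeltaChain r (Finset.univ.image b) n a) :
    ∃ i : Fin (n + 1) → Fin N, StrictMono i ∧ ∀ j : Fin (n + 1), b (i j) = a j := by
  have hex : ∀ j : Fin (n + 1), ∃ i, b i = a j := fun j => by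
    simpa using h.1 j (Nat.le_of_lt_succ j.2)
  choose i hi using hex
  refine ⟨i, Fin.strictMono_iff_lt_succ.2 fun j => hb.lt_iff_lt.1 ?_, hi⟩
  rw [hi, hi]
  exact h.2.1 j j.2

/-- Let `n ≥ 1` and let `b 0 < b 1 < ⋯ < b (2^(2n) - 1)` be nonnegative integers.
Then there exist indices `i 0 < i 1 < ⋯ < i n` such that the sequence
`δ(b (i 0), b (i 1)), …, δ(b (i (n-1)), b (i n))` is strictly monotone. -/
theorem stmt11 (n : ℕ) (hn : 1 ≤ n) (b : Fin (2 ^ (2 * n)) → ℕ) (hb : StrictMono b) :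
    ∃ i : Fin (n + 1) → Fin (2 ^ (2 * n)), StrictMono i ∧
      (StrictMono (fun l : Fin n => bdelta (b (i l.castSucc)) (b (i l.succ))) ∨
        StrictAnti (fun l : Fin n => bdelta (b (i l.castSucc)) (b (i l.succ)))) := by
  obtain ⟨m, rfl⟩ := Nat.exists_eq_add_of_le' hn
  set S := Finset.univ.image b
  have hcard : 2 ^ (m + 1 + (m + 1)) ≤ S.card := by
    rw [Finset.card_image_of_injective _ hb.injective, Finset.card_fin, two_mul]
  have hdiv : ∀ x ∈ S, x / 2 ^ S.sup id = 0 := fun x hx =>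
    Nat.div_eq_of_lt ((Finset.le_sup (f := id) hx).trans_lt Nat.lt_two_pow_self)
  rcases exists_isDeltaChain _ 0 (m + 1) (m + 1) S hdiv hcard with ⟨a, ha⟩ | ⟨a, ha⟩
  · obtain ⟨i, hi, hia⟩ := ha.exists_index hb
    refine ⟨i, hi, .inl (Fin.strictMono_iff_lt_succ.2 fun j => ?_)⟩
    simpa [hia] using ha.2.2 j (by omega)
  · obtain ⟨i, hi, hia⟩ := ha.exists_index hb
    refine ⟨i, hi, .inr (Fin.strictAnti_iff_succ_lt.2 fun j => ?_)⟩
    simpa [hia] using ha.2.2 j (by omega)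
end

section
/- Let N ≥ 1 and let H' be a 4-uniform hypergraph on vertex set {0, 1, ..., N−1} containing no 6 vertices all of whose 4-subsets are edges. Define a 5-uniform hypergraph H on {0, 1, ..., 2^N − 1} by: a 5-tuple e = (a_1 < ... < a_5) is an edge of H if and only if either (I) m(e) = 0 (i.e., δ_1, δ_2, δ_3, δ_4 form a strictly monotone sequence) and {δ_1, δ_2, δ_3, δ_4} is an edge of H', or (II) m(e) = 2. Then H contains no 7 vertices all of whose 5-subsets are edges. -/
/-- For a tuple `a 1 < a 2 < ⋯` of nonnegative integers, `dseq a i = δ(a i, a (i+1))`. -/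
noncomputable def dseq (a : ℕ → ℕ) (i : ℕ) : ℕ := bdelta (a i) (a (i + 1))

/-- The index `i` is a local extremum of the δ-sequence of the tuple `a`:
`δ_{i-1} < δ_i > δ_{i+1}` or `δ_{i-1} > δ_i < δ_{i+1}`. -/
def IsLocalExt (a : ℕ → ℕ) (i : ℕ) : Prop :=
  (dseq a (i - 1) < dseq a i ∧ dseq a (i + 1) < dseq a i) ∨
    (dseq a i < dseq a (i - 1) ∧ dseq a i < dseq a (i + 1))

open Classical in
/-- `numExtrema r a` is `m(e)`: the number of local extrema of the δ-sequence
`δ_1, …, δ_{r-1}` of an increasing `r`-tuple `e = (a 1, …, a r)`; the possible local extrema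
are the indices `2 ≤ i ≤ r - 2`. -/
noncomputable def numExtrema (r : ℕ) (a : ℕ → ℕ) : ℕ :=
  ((Finset.Icc 2 (r - 2)).filter (fun i => IsLocalExt a i)).card

/-- The δ-sequence `δ_1, …, δ_{r-1}` of the `r`-tuple `(a 1, …, a r)` is strictly monotone. -/
def DMonotone (r : ℕ) (a : ℕ → ℕ) : Prop :=
  (∀ i, 1 ≤ i → i + 1 ≤ r - 1 → dseq a i < dseq a (i + 1)) ∨
    (∀ i, 1 ≤ i → i + 1 ≤ r - 1 → dseq a (i + 1) < dseq a i)

theorem bdelta_eq_of_testBit {a b d : ℕ} (h : a.testBit d ≠ b.testBit d)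
    (heq : ∀ j, d < j → a.testBit j = b.testBit j) : bdelta a b = d :=
  IsGreatest.csSup_eq ⟨h, fun j hj => not_lt.1 fun hlt => hj (heq j hlt)⟩

theorem testBit_bdelta {a b : ℕ} (h : a < b) :
    a.testBit (bdelta a b) = false ∧ b.testBit (bdelta a b) = true ∧
      ∀ j, bdelta a b < j → a.testBit j = b.testBit j := by
  have hne : {i | a.testBit i ≠ b.testBit i}.Nonempty := by
    obtain ⟨i, hi⟩ := Nat.exists_testBit_ne_of_ne h.ne
    exact ⟨i, hi⟩
  have hbdd : BddAbove {i | a.testBit i ≠ b.testBit i} := by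
    refine ⟨b, fun i hi => not_lt.1 fun hlt => hi ?_⟩
    have hb : b < 2 ^ i := hlt.trans Nat.lt_two_pow_self
    rw [Nat.testBit_lt_two_pow hb, Nat.testBit_lt_two_pow (h.trans hb)]
  have hmem : a.testBit (bdelta a b) ≠ b.testBit (bdelta a b) := Nat.sSup_mem hne hbdd
  have heq : ∀ j, bdelta a b < j → a.testBit j = b.testBit j := fun j hj => by
    by_contra hj'
    exact (le_csSup hbdd hj').not_gt hj
  cases ha : a.testBit (bdelta a b) <;> cases hb : b.testBit (bdelta a b)
  · simp_all
  · exact ⟨rfl, rfl, heq⟩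
  · exact absurd (Nat.lt_of_testBit _ hb ha fun j hj => (heq j hj).symm) h.not_gt
  · simp_all

theorem bdelta_ne {a b c : ℕ} (hab : a < b) (hbc : b < c) : bdelta a b ≠ bdelta b c := by
  intro h
  have h1 := (testBit_bdelta hab).2.1
  have h2 := (testBit_bdelta hbc).1
  simp_all

theorem bdelta_eq_max {a b c : ℕ} (hab : a < b) (hbc : b < c) :
    bdelta a c = max (bdelta a b) (bdelta b c) := by
  obtain ⟨h1, h2, h3⟩ := testBit_bdelta hab
  obtain ⟨h4, h5, h6⟩ := testBit_bdelta hbc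
  rcases (bdelta_ne hab hbc).lt_or_gt with h | h
  · rw [max_eq_right h.le]
    refine bdelta_eq_of_testBit ?_ fun j hj => (h3 j (h.trans hj)).trans (h6 j hj)
    simp [h3 _ h, h4, h5]
  · rw [max_eq_left h.le]
    refine bdelta_eq_of_testBit ?_ fun j hj => (h3 j hj).trans (h6 j (h.trans hj))
    simp [← h6 _ h, h1, h2]

theorem bdelta_lt_s14 {a b N : ℕ} (hab : a < b) (hb : b < 2 ^ N) : bdelta a b < N :=
  (Nat.pow_lt_pow_iff_right one_lt_two).1
    ((Nat.ge_two_pow_of_testBit (testBit_bdelta hab).2.1).trans_lt hb)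

/-- The condition for a 5-tuple with δ-sequence `p, q, r, s` to be an edge: the sequence is
strictly monotone with its set of values in `E'`, or it has two local extrema. -/
def EdgeCond (E' : Finset ℕ → Prop) (p q r s : ℕ) : Prop :=
  ((p < q ∧ q < r ∧ r < s ∨ q < p ∧ r < q ∧ s < r) ∧ E' {p, q, r, s}) ∨
    (p < q ∧ r < q ∧ r < s ∨ q < p ∧ q < r ∧ s < r)

theorem EdgeCond.edge_of_lt {E' : Finset ℕ → Prop} {p q r s : ℕ} (h : EdgeCond E' p q r s)
    (hpq : p < q) (hqr : q < r) : E' {p, q, r, s} := by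
  rcases h with h | h
  · exact h.2
  · lia

theorem EdgeCond.edge_of_gt {E' : Finset ℕ → Prop} {p q r s : ℕ} (h : EdgeCond E' p q r s)
    (hpq : q < p) (hqr : r < q) : E' {p, q, r, s} := by
  rcases h with h | h
  · exact h.2
  · lia

theorem numExtrema_five_eq_two_iff (a : ℕ → ℕ) :
    numExtrema 5 a = 2 ↔ IsLocalExt a 2 ∧ IsLocalExt a 3 := by
  classical
  have h : Finset.Icc 2 (5 - 2) = ({2, 3} : Finset ℕ) := by decide
  by_cases h2 : IsLocalExt a 2 <;> by_cases h3 : IsLocalExt a 3 <;>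
    simp [numExtrema, h, Finset.filter_insert, Finset.filter_singleton, h2, h3]

theorem edgeCond_of_edge {a : ℕ → ℕ} {E' : Finset ℕ → Prop}
    (h : (DMonotone 5 a ∧ E' ({dseq a 1, dseq a 2, dseq a 3, dseq a 4} : Finset ℕ)) ∨
      numExtrema 5 a = 2) : EdgeCond E' (dseq a 1) (dseq a 2) (dseq a 3) (dseq a 4) := by
  rcases h with ⟨h, he⟩ | h
  · exact Or.inl ⟨h.imp
      (fun h => ⟨h 1 (by lia) (by lia), h 2 (by lia) (by lia), h 3 (by lia) (by lia)⟩)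
      (fun h => ⟨h 1 (by lia) (by lia), h 2 (by lia) (by lia), h 3 (by lia) (by lia)⟩), he⟩
  · rw [numExtrema_five_eq_two_iff] at h
    simp only [IsLocalExt, Nat.reduceAdd, Nat.reduceSub] at h
    right
    lia

theorem edgeCond_of_forall {N : ℕ} {E E' : Finset ℕ → Prop}
    (hE : ∀ a : ℕ → ℕ, (∀ i, 1 ≤ i → i < 5 → a i < a (i + 1)) → a 5 < 2 ^ N →
      (E ((Finset.Icc 1 5).image a) ↔
        (DMonotone 5 a ∧ E' ({dseq a 1, dseq a 2, dseq a 3, dseq a 4} : Finset ℕ)) ∨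
          numExtrema 5 a = 2))
    {S : Finset ℕ} (hSE : ∀ e ⊆ S, e.card = 5 → E e) {v w x y z : ℕ}
    (hv : v ∈ S) (hw : w ∈ S) (hx : x ∈ S) (hy : y ∈ S) (hz : z ∈ S)
    (hvw : v < w) (hwx : w < x) (hxy : x < y) (hyz : y < z) (hzN : z < 2 ^ N) :
    EdgeCond E' (bdelta v w) (bdelta w x) (bdelta x y) (bdelta y z) := by
  let a : ℕ → ℕ := fun i => [v, v, w, x, y, z].getD i 0
  have himage : (Finset.Icc 1 5).image a = {v, w, x, y, z} := by
    have h : Finset.Icc 1 5 = ({1, 2, 3, 4, 5} : Finset ℕ) := by decide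
    simp [h, a, Finset.image_insert]
  have hmono : ∀ i, 1 ≤ i → i < 5 → a i < a (i + 1) := by
    intro i h1 h5
    interval_cases i <;> simpa [a]
  have hcard : ({v, w, x, y, z} : Finset ℕ).card = 5 := by
    repeat rw [Finset.card_insert_of_notMem (by simp; lia)]
    rw [Finset.card_singleton]
  have hedge : E ((Finset.Icc 1 5).image a) := by
    rw [himage]
    refine hSE _ ?_ hcard
    simp [Finset.insert_subset_iff, hv, hw, hx, hy, hz]
  exact edgeCond_of_edge ((hE a hmono (by simpa [a])).1 hedge)

theorem exists_strictMonoOn_of_card {n : ℕ} (S : Finset ℕ) (hS : S.card = n) :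
    ∃ a : ℕ → ℕ, (∀ i j, i < j → j < n → a i < a j) ∧ ∀ i < n, a i ∈ S := by
  refine ⟨fun i => if h : i < n then S.orderEmbOfFin hS ⟨i, h⟩ else 0, ?_, ?_⟩
  · intro i j hij hj
    simp [hj, hij.trans hj, hij]
  · intro i hi
    simp [hi]

theorem rel_of_forall_rel_succ {α : Type*} {r : α → α → Prop} [IsTrans α r] {f : ℕ → α} {n : ℕ}
    (h : ∀ i < n, r (f i) (f (i + 1))) : ∀ i j, i < j → j < n + 1 → r (f i) (f j) := by
  intro i j hij
  induction j, hij using Nat.le_induction with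
  | base => exact fun hj => h i (by lia)
  | succ j hij ih => exact fun hj => _root_.trans (ih (by lia)) (h j (by lia))

theorem bdelta_eq_last {a : ℕ → ℕ} {n : ℕ} (ha : ∀ i j, i < j → j < n → a i < a j)
    (hd : ∀ i, i + 2 < n → dseq a i < dseq a (i + 1)) {p q : ℕ} (hpq : p ≤ q) :
    q + 1 < n → bdelta (a p) (a (q + 1)) = dseq a q := by
  induction q, hpq using Nat.le_induction with
  | base => exact fun _ => rfl
  | succ q hpq ih =>
    intro hq
    rw [bdelta_eq_max (ha p (q + 1) (by lia) (by lia)) (ha (q + 1) (q + 1 + 1) (by lia) hq),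
      ih (by lia)]
    exact max_eq_right (hd q hq).le

theorem bdelta_eq_first {a : ℕ → ℕ} {n : ℕ} (ha : ∀ i j, i < j → j < n → a i < a j)
    (hd : ∀ i j, i < j → j + 1 < n → dseq a j < dseq a i) {p q : ℕ} (hpq : p < q) :
    q < n → bdelta (a p) (a q) = dseq a p := by
  induction q, hpq using Nat.le_induction with
  | base => exact fun _ => rfl
  | succ q hpq ih =>
    intro hq
    rw [bdelta_eq_max (ha p q hpq (by lia)) (ha q (q + 1) (by lia) hq), ih (by lia)]
    exact max_eq_left (hd p q hpq hq).le

theorem exists_eq_of_card_eq_four {I : Finset ℕ} (hI : I.card = 4) :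
    ∃ i j k l, i < j ∧ j < k ∧ k < l ∧ I = {i, j, k, l} := by
  refine ⟨I.orderEmbOfFin hI 0, I.orderEmbOfFin hI 1, I.orderEmbOfFin hI 2, I.orderEmbOfFin hI 3,
    by simp, by simp, by simp, ?_⟩
  ext x
  rw [← Finset.mem_coe, ← Finset.range_orderEmbOfFin I hI]
  simp [-Finset.range_orderEmbOfFin, Fin.exists_fin_succ, eq_comm]

theorem exists_six_clique {N : ℕ} {E' : Finset ℕ → Prop} {d : ℕ → ℕ} (hdN : ∀ i < 6, d i < N)
    (hd : ∀ i j, i < j → j < 6 → d i ≠ d j)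
    (h : ∀ i j k l, i < j → j < k → k < l → l < 6 → E' {d i, d j, d k, d l}) :
    ∃ S ⊆ Finset.range N, S.card = 6 ∧ ∀ e ⊆ S, e.card = 4 → E' e := by
  have hinj : Set.InjOn d (Finset.range 6) := by
    intro i hi j hj hij
    simp only [Finset.coe_range, Set.mem_Iio] at hi hj
    rcases lt_trichotomy i j with hlt | heq | hlt
    · exact absurd hij (hd i j hlt hj)
    · exact heq
    · exact absurd hij.symm (hd j i hlt hi)
  refine ⟨(Finset.range 6).image d, ?_, ?_, ?_⟩
  · intro x hx
    obtain ⟨i, hi, rfl⟩ := Finset.mem_image.1 hx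
    exact Finset.mem_range.2 (hdN i (Finset.mem_range.1 hi))
  · rw [Finset.card_image_of_injOn hinj, Finset.card_range]
  · intro e he hcard
    obtain ⟨I, hI, rfl⟩ := Finset.subset_image_iff.1 he
    rw [Finset.card_image_of_injOn (hinj.mono hI)] at hcard
    obtain ⟨i, j, k, l, hij, hjk, hkl, rfl⟩ := exists_eq_of_card_eq_four hcard
    have hl : l < 6 := by simpa using @hI l (by simp)
    simpa [Finset.image_insert] using h i j k l hij hjk hkl hl

/-- Let `N ≥ 1` and let `E'` be a 4-uniform hypergraph on `{0,…,N-1}` containing no 6 vertices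
all of whose 4-subsets are edges. Define a 5-uniform hypergraph `E` on `{0,…,2^N - 1}` by: a
5-tuple `e = (a₁ < ⋯ < a₅)` is an edge iff (I) its δ-sequence `δ₁,δ₂,δ₃,δ₄` is strictly
monotone (`m(e) = 0`) and `{δ₁,δ₂,δ₃,δ₄}` is an edge of `E'`, or (II) `m(e) = 2`.
Then `E` contains no 7 vertices all of whose 5-subsets are edges. -/
theorem stmt14 (N : ℕ) (hN : 1 ≤ N) (E' : Finset ℕ → Prop)
    (hE' : ¬ ∃ S ⊆ Finset.range N, S.card = 6 ∧ ∀ e ⊆ S, e.card = 4 → E' e)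
    (E : Finset ℕ → Prop)
    (hE : ∀ a : ℕ → ℕ, (∀ i, 1 ≤ i → i < 5 → a i < a (i + 1)) → a 5 < 2 ^ N →
      (E ((Finset.Icc 1 5).image a) ↔
        (DMonotone 5 a ∧ E' ({dseq a 1, dseq a 2, dseq a 3, dseq a 4} : Finset ℕ)) ∨
          numExtrema 5 a = 2)) :
    ¬ ∃ S ⊆ Finset.range (2 ^ N), S.card = 7 ∧ ∀ e ⊆ S, e.card = 5 → E e := by
  rintro ⟨S, hSN, hS, hSE⟩
  obtain ⟨a, ha, haS⟩ := exists_strictMonoOn_of_card S hS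
  have hN' : ∀ i < 7, a i < 2 ^ N := fun i hi => Finset.mem_range.1 (hSN (haS i hi))
  have key : ∀ i j k l m, i < j → j < k → k < l → l < m → m < 7 →
      EdgeCond E' (bdelta (a i) (a j)) (bdelta (a j) (a k)) (bdelta (a k) (a l))
        (bdelta (a l) (a m)) := by
    intro i j k l m hij hjk hkl hlm hm
    exact edgeCond_of_forall hE hSE (haS i (by lia)) (haS j (by lia)) (haS k (by lia))
      (haS l (by lia)) (haS m hm) (ha i j hij (by lia)) (ha j k hjk (by lia))
      (ha k l hkl (by lia)) (ha l m hlm hm) (hN' m hm)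
  have hne : ∀ i j k, i < j → j < k → k < 7 → bdelta (a i) (a j) ≠ bdelta (a j) (a k) :=
    fun i j k hij hjk hk => bdelta_ne (ha i j hij (by lia)) (ha j k hjk hk)
  have hmax : ∀ i j k, i < j → j < k → k < 7 →
      bdelta (a i) (a k) = max (bdelta (a i) (a j)) (bdelta (a j) (a k)) :=
    fun i j k hij hjk hk => bdelta_eq_max (ha i j hij (by lia)) (ha j k hjk hk)
  have no_zigzag : ∀ i, i + 5 < 7 → ¬ (dseq a i < dseq a (i + 1) ∧ dseq a (i + 2) < dseq a (i + 1) ∧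
      dseq a (i + 2) < dseq a (i + 3) ∧ dseq a (i + 4) < dseq a (i + 3)) := by
    rintro i hi ⟨h1, h2, h3, h4⟩
    have e1 := key i (i + 1) (i + 2) (i + 4) (i + 5) (by lia) (by lia) (by lia) (by lia) hi
    have e2 := key i (i + 1) (i + 3) (i + 4) (i + 5) (by lia) (by lia) (by lia) (by lia) hi
    have m1 := hmax (i + 1) (i + 2) (i + 3) (by lia) (by lia) (by lia)
    have m2 := hmax (i + 2) (i + 3) (i + 4) (by lia) (by lia) (by lia)
    have n1 := hne (i + 1) (i + 3) (i + 4) (by lia) (by lia) (by lia)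
    simp only [dseq, add_assoc, Nat.reduceAdd] at *
    rw [max_eq_left h2.le] at m1
    rw [max_eq_right h3.le] at m2
    rw [m1] at n1 e2
    rw [m2] at e1
    rcases e1 with ⟨e1, -⟩ | e1 <;> rcases e2 with ⟨e2, -⟩ | e2 <;> lia
  have k0 := key 0 1 2 3 4 (by lia) (by lia) (by lia) (by lia) (by lia)
  have k1 := key 1 2 3 4 5 (by lia) (by lia) (by lia) (by lia) (by lia)
  have k2 := key 2 3 4 5 6 (by lia) (by lia) (by lia) (by lia) (by lia)
  have z0 := no_zigzag 0 (by lia)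
  have z1 := no_zigzag 1 (by lia)
  simp only [dseq, Nat.reduceAdd] at z0 z1
  have hdN : ∀ i < 6, dseq a i < N := fun i hi =>
    bdelta_lt_s14 (ha i (i + 1) (by lia) (by lia)) (hN' (i + 1) (by lia))
  have hmono : (∀ i < 5, dseq a i < dseq a (i + 1)) ∨ (∀ i < 5, dseq a (i + 1) < dseq a i) := by
    suffices h : (dseq a 0 < dseq a 1 ∧ dseq a 1 < dseq a 2 ∧ dseq a 2 < dseq a 3 ∧
        dseq a 3 < dseq a 4 ∧ dseq a 4 < dseq a 5) ∨ (dseq a 1 < dseq a 0 ∧ dseq a 2 < dseq a 1 ∧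
        dseq a 3 < dseq a 2 ∧ dseq a 4 < dseq a 3 ∧ dseq a 5 < dseq a 4) by
      refine h.imp ?_ ?_ <;>
      · rintro h i hi
        interval_cases i <;> simp [h]
    simp only [dseq, Nat.reduceAdd]
    rcases k0 with ⟨k0, -⟩ | k0 <;> rcases k1 with ⟨k1, -⟩ | k1 <;>
      rcases k2 with ⟨k2, -⟩ | k2 <;> omega
  rcases hmono with h | h
  · have hd := rel_of_forall_rel_succ (r := (· < ·)) h
    refine hE' (exists_six_clique hdN (fun i j hij hj => (hd i j hij hj).ne) ?_)
    intro i j k l hij hjk hkl hl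
    have e := key i (i + 1) (j + 1) (k + 1) (l + 1) (by lia) (by lia) (by lia) (by lia) (by lia)
    have last : ∀ p q, p ≤ q → q < 6 → bdelta (a p) (a (q + 1)) = dseq a q :=
      fun p q hpq hq => bdelta_eq_last ha (fun i hi => h i (by lia)) hpq (by lia)
    rw [last i i le_rfl (by lia), last _ j hij (by lia), last _ k hjk (by lia),
      last _ l hkl hl] at e
    exact e.edge_of_lt (hd i j hij (by lia)) (hd j k hjk (by lia))
  · have hd := rel_of_forall_rel_succ (r := (· > ·)) h
    refine hE' (exists_six_clique hdN (fun i j hij hj => (hd i j hij hj).ne') ?_)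
    intro i j k l hij hjk hkl hl
    have e := key i j k l (l + 1) hij hjk hkl (by lia) (by lia)
    have first : ∀ p q, p < q → q < 7 → bdelta (a p) (a q) = dseq a p :=
      fun p q hpq hq => bdelta_eq_first ha (fun i j hij hj => hd i j hij (by lia)) hpq hq
    rw [first i j hij (by lia), first j k hjk (by lia), first k l hkl (by lia),
      first l (l + 1) (by lia) (by lia)] at e
    exact e.edge_of_gt (hd i j hij (by lia)) (hd j k hjk (by lia))
end
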